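/- arXiv:1106.0023 — 2 statements merged into one kernel-verified Lean document; each statement's English description precedes it below -/
import Mathlib

section
/- Let κ_1, …, κ_n be real numbers and let A be a real k×n matrix. Define f_j(t) = Σ_{i=1}^n A_{j i} e^{κ_i t} for j = 1, …, k. Then for every t ∈ ℝ, the Wronskian Wr(f_1, …, f_k)(t) equals Σ_I Δ_I(A) · ∏_{1 ≤ l < m ≤ k} (κ_{i_m} − κ_{i_l}) · e^{(Σ_{i ∈ I} κ_i) t}, where the sum runs over all k-element subsets I = {i_1 < i_2 < ⋯ < i_k} of {1, …, n}. -/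
open scoped BigOperators

/-- The maximal minor of a `k × n` matrix `A` on the column set `I` (columns taken in
increasing order); defined to be `0` if `I` does not have exactly `k` elements. -/
noncomputable def minor {k n : ℕ} (A : Matrix (Fin k) (Fin n) ℝ) (I : Finset (Fin n)) : ℝ :=
  if h : I.card = k then
    Matrix.det (Matrix.of fun r c : Fin k => A r ((I.orderIsoOfFin h c : Fin n)))
  else 0

/-- `∏_{l<m} (κ_{i_m} - κ_{i_l})` over the elements `i_1 < ⋯ < i_k` of `I`. -/
noncomputable def pairProd {n : ℕ} (κ : Fin n → ℝ) (I : Finset (Fin n)) : ℝ :=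
  ∏ p ∈ (I ×ˢ I).filter (fun p : Fin n × Fin n => p.1 < p.2), (κ p.2 - κ p.1)

open Finset in
/-- The terms of the multilinear expansion of `det (A * B)` indexed by the injections onto `I`
add up to the product of the minors of `A` and `B` on `I`. -/
theorem sum_image_eq_det_submatrix_mul {R ι : Type*} [CommRing R] [Fintype ι] [LinearOrder ι]
    {k : ℕ} (A : Matrix (Fin k) ι R) (B : Matrix ι (Fin k) R) (I : Finset ι) (hI : #I = k) :
    ∑ f : Fin k → ι with Function.Injective f ∧ univ.image f = I,
        (∏ j, A j (f j)) * (B.submatrix f id).det =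
      (A.submatrix id (I.orderEmbOfFin hI)).det * (B.submatrix (I.orderEmbOfFin hI) id).det := by
  have key : ∑ σ : Equiv.Perm (Fin k), (∏ j, A j (I.orderEmbOfFin hI (σ j))) *
        (B.submatrix (I.orderEmbOfFin hI ∘ σ) id).det =
      ∑ f : Fin k → ι with Function.Injective f ∧ univ.image f = I,
        (∏ j, A j (f j)) * (B.submatrix f id).det := by
    refine sum_bij (fun σ _ => I.orderEmbOfFin hI ∘ σ) ?_ ?_ ?_ ?_
    · intro σ _
      refine mem_filter.2 ⟨mem_univ _, (I.orderEmbOfFin hI).injective.comp σ.injective, ?_⟩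
      rw [← image_image, image_univ_equiv, image_orderEmbOfFin_univ]
    · intro σ _ τ _ h
      ext j
      exact congrArg Fin.val ((I.orderEmbOfFin hI).injective (congrFun h j))
    · intro f hf
      obtain ⟨-, hinj, himg⟩ := mem_filter.1 hf
      have hmem (j : Fin k) : f j ∈ I := himg ▸ mem_image_of_mem f (mem_univ j)
      have hg : Function.Injective fun j => (I.orderIsoOfFin hI).symm ⟨f j, hmem j⟩ := by
        intro a b h
        exact hinj (congrArg Subtype.val ((I.orderIsoOfFin hI).symm.injective h))
      refine ⟨Equiv.ofBijective _ (Finite.injective_iff_bijective.1 hg), mem_univ _, ?_⟩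
      ext j
      simp [← coe_orderIsoOfFin_apply]
    · intro σ _
      rfl
  rw [← key, ← Matrix.det_transpose (A.submatrix _ _), Matrix.det_apply', sum_mul]
  refine sum_congr rfl fun σ _ => ?_
  have h : B.submatrix (I.orderEmbOfFin hI ∘ σ) id =
      (B.submatrix (I.orderEmbOfFin hI) id).submatrix σ id := rfl
  rw [h, Matrix.det_permute]
  simp only [Matrix.transpose_apply, Matrix.submatrix_apply, id]
  ring

open Finset in
/-- The Cauchy–Binet formula. -/
theorem det_mul_eq_sum_det_submatrix {R ι : Type*} [CommRing R] [Fintype ι] [LinearOrder ι]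
    {k : ℕ} (A : Matrix (Fin k) ι R) (B : Matrix ι (Fin k) R) :
    (A * B).det = ∑ I : powersetCard k (univ : Finset ι),
      (A.submatrix id (I.1.orderEmbOfFin (mem_powersetCard.1 I.2).2)).det *
        (B.submatrix (I.1.orderEmbOfFin (mem_powersetCard.1 I.2).2) id).det := by
  have expand : (A * B).det =
      ∑ f : Fin k → ι, (∏ j, A j (f j)) * (B.submatrix f id).det := by
    have hrow : A * B = fun j => ∑ i, A j i • B i := by
      ext j m
      simp [Matrix.mul_apply]
    rw [hrow]
    refine (Matrix.detRowAlternating.toMultilinearMap.map_sum _).trans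
      (sum_congr rfl fun f _ => ?_)
    exact Matrix.detRowAlternating.toMultilinearMap.map_smul_univ _ _
  rw [expand, ← sum_filter_of_ne (p := Function.Injective) fun f _ hf => ?_]
  · rw [← sum_fiberwise_of_maps_to (t := powersetCard k univ) (g := fun f => univ.image f),
      ← sum_coe_sort]
    · refine sum_congr rfl fun I _ => ?_
      rw [filter_filter, sum_image_eq_det_submatrix_mul]
    · intro f hf
      rw [mem_powersetCard, card_image_of_injective _ (mem_filter.1 hf).2]
      simp
  · by_contra h
    obtain ⟨a, b, hab, hne⟩ := Function.not_injective_iff.1 h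
    refine hf ?_
    rw [Matrix.det_zero_of_row_eq hne (by ext m; simp [hab]), mul_zero]

/-- The Vandermonde determinant on the increasing enumeration of `I` is `pairProd κ I`. -/
theorem det_vandermonde_orderEmbOfFin {k n : ℕ} (κ : Fin n → ℝ) (I : Finset (Fin n))
    (hI : I.card = k) :
    (Matrix.vandermonde (κ ∘ I.orderEmbOfFin hI)).det = pairProd κ I := by
  rw [Matrix.det_vandermonde, pairProd, Finset.prod_sigma']
  refine Finset.prod_bij (fun p _ => (I.orderEmbOfFin hI p.1, I.orderEmbOfFin hI p.2)) ?_ ?_ ?_ ?_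
  · rintro ⟨a, b⟩ h
    simpa using h
  · rintro ⟨a, b⟩ _ ⟨c, d⟩ _ h
    simpa using h
  · rintro ⟨x, y⟩ h
    obtain ⟨hxy, hlt⟩ := Finset.mem_filter.1 h
    obtain ⟨hx, hy⟩ := Finset.mem_product.1 hxy
    rw [← Finset.mem_coe, ← Finset.range_orderEmbOfFin I hI] at hx hy
    obtain ⟨a, rfl⟩ := hx
    obtain ⟨b, rfl⟩ := hy
    exact ⟨⟨a, b⟩, by simpa using hlt, rfl⟩
  · intro p _
    rfl

theorem iteratedDeriv_sum_mul_exp {ι : Type*} [Fintype ι] (a κ : ι → ℝ) (m : ℕ) (t : ℝ) :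
    iteratedDeriv m (fun s : ℝ => ∑ i, a i * Real.exp (κ i * s)) t =
      ∑ i, a i * (Real.exp (κ i * t) * κ i ^ m) := by
  rw [iteratedDeriv_fun_sum fun i _ => by fun_prop]
  refine Finset.sum_congr rfl fun i _ => ?_
  rw [iteratedDeriv_const_mul_field, iteratedDeriv_exp_const_mul]
  ring

/-- the Wronskian of `f_j(t) = ∑_i A j i · exp (κ i t)` is
`∑_I Δ_I(A) ∏_{l<m} (κ_{i_m} - κ_{i_l}) exp ((∑_{i ∈ I} κ i) t)`, the sum running over
all `k`-element subsets `I` of the column indices. -/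
theorem wronskian_eq_sum_of_minors {k n : ℕ} (κ : Fin n → ℝ)
    (A : Matrix (Fin k) (Fin n) ℝ) (t : ℝ) :
    Matrix.det (Matrix.of fun j m : Fin k =>
        iteratedDeriv (m : ℕ)
          (fun s : ℝ => ∑ i : Fin n, A j i * Real.exp (κ i * s)) t) =
      ∑ I ∈ Finset.powersetCard k (Finset.univ : Finset (Fin n)),
        minor A I * pairProd κ I * Real.exp ((∑ i ∈ I, κ i) * t) := by
  have hmul : (Matrix.of fun j m : Fin k => iteratedDeriv (m : ℕ)
        (fun s : ℝ => ∑ i : Fin n, A j i * Real.exp (κ i * s)) t) =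
      A * Matrix.of fun (i : Fin n) (m : Fin k) => Real.exp (κ i * t) * κ i ^ (m : ℕ) := by
    ext j m
    simp [iteratedDeriv_sum_mul_exp, Matrix.mul_apply]
  rw [hmul, det_mul_eq_sum_det_submatrix, ← Finset.sum_coe_sort (Finset.powersetCard k _)]
  refine Finset.sum_congr rfl fun I _ => ?_
  obtain ⟨I, hmem⟩ := I
  have hI := (Finset.mem_powersetCard.1 hmem).2
  have hminor : (A.submatrix id (I.orderEmbOfFin hI)).det = minor A I := by
    rw [minor, dif_pos hI]
    rfl
  have hexp : ∏ c, Real.exp (κ (I.orderEmbOfFin hI c) * t) = Real.exp ((∑ i ∈ I, κ i) * t) := by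
    rw [← Real.exp_sum, ← Finset.sum_mul]
    conv_rhs => rw [← Finset.map_orderEmbOfFin_univ I hI, Finset.sum_map]
    rfl
  have hdet := Matrix.det_mul_column (fun c => Real.exp (κ (I.orderEmbOfFin hI c) * t))
    (Matrix.vandermonde (κ ∘ I.orderEmbOfFin hI))
  rw [hexp, det_vandermonde_orderEmbOfFin] at hdet
  rw [hminor, mul_assoc, mul_comm (pairProd κ I), ← hdet]
  rfl
end

section
/- Fix real parameters κ_1 < κ_2 < ⋯ < κ_n. Let A be a real k×n matrix of rank k all of whose k×k minors are nonnegative, and define τ_A(x,y,t) := Σ_I Δ_I(A) · ∏_{1 ≤ l < m ≤ k} (κ_{i_m} − κ_{i_l}) · exp(Σ_{i ∈ I} (κ_i x + κ_i² y + κ_i³ t)), summed over all k-element subsets I = {i_1 < ⋯ < i_k} of {1, …, n}. Then τ_A is strictly positive and infinitely differentiable on ℝ³, and consequently the KP soliton solution u_A(x,y,t) := 2 ∂²/∂x² (log τ_A(x,y,t)) is a well-defined C^∞ function on all of ℝ³ (i.e. the solution is regular for all x, y, t). -/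
open scoped BigOperators

/-- The KP τ-function of a `k × n` matrix `A` with parameters `κ`. -/
noncomputable def tau {k n : ℕ} (A : Matrix (Fin k) (Fin n) ℝ) (κ : Fin n → ℝ)
    (x y t : ℝ) : ℝ :=
  ∑ I ∈ Finset.powersetCard k (Finset.univ : Finset (Fin n)),
    minor A I * pairProd κ I *
      Real.exp (∑ i ∈ I, (κ i * x + κ i ^ 2 * y + κ i ^ 3 * t))

/-- A matrix of full row rank has a nonvanishing maximal minor. -/
theorem exists_minor_ne_zero {k n : ℕ} (A : Matrix (Fin k) (Fin n) ℝ) (hrank : A.rank = k) :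
    ∃ I : Finset (Fin n), I.card = k ∧ minor A I ≠ 0 := by
  obtain ⟨s, hspan, hli⟩ :
      ∃ s : Set (Fin n), Submodule.span ℝ (Set.image A.col s) = Submodule.span ℝ (Set.range A.col) ∧
        LinearIndependent ℝ (fun i : s => A.col i) := by
    obtain ⟨ι, a, ha, hspan, hli⟩ := exists_linearIndependent' ℝ A.col
    refine ⟨Set.range a, ?_, ?_⟩
    · rw [← Set.range_comp, hspan]
    · exact (linearIndependent_equiv (Equiv.ofInjective a ha)).mp hli
  classical
  have hcard : s.toFinset.card = k := by
    rw [← hrank, A.rank_eq_finrank_span_cols, ← hspan, Set.toFinset_card, Set.image_eq_range]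
    exact (finrank_span_eq_card hli).symm
  refine ⟨s.toFinset, hcard, ?_⟩
  rw [minor, dif_pos hcard, ← isUnit_iff_ne_zero, ← Matrix.isUnit_iff_isUnit_det,
    ← Matrix.linearIndependent_cols_iff_isUnit]
  exact hli.comp (fun c => ⟨s.toFinset.orderIsoOfFin hcard c, Set.mem_toFinset.mp (Subtype.prop _)⟩)
    fun c d h => (s.toFinset.orderIsoOfFin hcard).injective (Subtype.ext (by simpa using h))

theorem pairProd_pos {n : ℕ} {κ : Fin n → ℝ} (hκ : StrictMono κ) (I : Finset (Fin n)) :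
    0 < pairProd κ I :=
  Finset.prod_pos fun _ hp => sub_pos.mpr (hκ (Finset.mem_filter.mp hp).2)

theorem tau_pos {k n : ℕ} {κ : Fin n → ℝ} (hκ : StrictMono κ) {A : Matrix (Fin k) (Fin n) ℝ}
    (hrank : A.rank = k) (hnonneg : ∀ I : Finset (Fin n), 0 ≤ minor A I) (x y t : ℝ) :
    0 < tau A κ x y t := by
  obtain ⟨I, hI, hminor⟩ := exists_minor_ne_zero A hrank
  refine Finset.sum_pos' (fun J _ => ?_) ⟨I, by simp [hI], ?_⟩
  · exact mul_nonneg (mul_nonneg (hnonneg J) (pairProd_pos hκ J).le) (Real.exp_pos _).le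
  · exact mul_pos (mul_pos ((hnonneg I).lt_of_ne' hminor) (pairProd_pos hκ I)) (Real.exp_pos _)

theorem contDiff_tau {k n : ℕ} (A : Matrix (Fin k) (Fin n) ℝ) (κ : Fin n → ℝ) :
    ContDiff ℝ (⊤ : ℕ∞) (fun p : ℝ × ℝ × ℝ => tau A κ p.1 p.2.1 p.2.2) := by
  unfold tau
  fun_prop

/-- The partial derivative of a smooth function in its first, real variable is smooth. -/
theorem ContDiff.deriv_fst {E : Type*} [NormedAddCommGroup E] [NormedSpace ℝ E]
    {f : ℝ × E → ℝ} (hf : ContDiff ℝ (⊤ : ℕ∞) f) :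
    ContDiff ℝ (⊤ : ℕ∞) (fun p : ℝ × E => deriv (fun x => f (x, p.2)) p.1) := by
  have h : (fun p : ℝ × E => deriv (fun x => f (x, p.2)) p.1) =
      fun p => fderiv ℝ f p (1, 0) := by
    funext p
    have hline : HasDerivAt (fun x : ℝ => (x, p.2)) ((1 : ℝ), (0 : E)) p.1 :=
      (hasDerivAt_id p.1).prodMk (hasDerivAt_const p.1 p.2)
    exact ((hf.differentiable (by simp) p).hasFDerivAt.comp_hasDerivAt p.1 hline).deriv
  rw [h]
  exact (hf.fderiv_right (by simp)).clm_apply contDiff_const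

/-- for increasing `κ` and a rank-`k` totally nonnegative matrix `A`, the
τ-function is positive and smooth on `ℝ³`, and hence the KP soliton solution
`u_A = 2 ∂²/∂x² log τ_A` is a well-defined `C^∞` function on all of `ℝ³`. -/
theorem kp_soliton_regular {k n : ℕ} (κ : Fin n → ℝ) (hκ : StrictMono κ)
    (A : Matrix (Fin k) (Fin n) ℝ) (hrank : A.rank = k)
    (hnonneg : ∀ I : Finset (Fin n), 0 ≤ minor A I) :
    (∀ x y t : ℝ, 0 < tau A κ x y t) ∧
    ContDiff ℝ (⊤ : ℕ∞) (fun p : ℝ × ℝ × ℝ => tau A κ p.1 p.2.1 p.2.2) ∧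
    ContDiff ℝ (⊤ : ℕ∞) (fun p : ℝ × ℝ × ℝ =>
      2 * iteratedDeriv 2 (fun x : ℝ => Real.log (tau A κ x p.2.1 p.2.2)) p.1) := by
  have hpos := tau_pos hκ hrank hnonneg
  have hsmooth := contDiff_tau A κ
  refine ⟨hpos, hsmooth, contDiff_const.mul ?_⟩
  simpa only [iteratedDeriv_succ, iteratedDeriv_zero] using
    (hsmooth.log fun p => (hpos p.1 p.2.1 p.2.2).ne').deriv_fst.deriv_fst
end
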